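/- arXiv:2402.13794 — 3 statements merged into one kernel-verified Lean document; each statement's English description precedes it below -/
import Mathlib

section
/- For the AdaGrad-with-momentum iterates with f L-smooth and bounded below, the pointwise noise condition holding, β ∈ [0,1), and T ≥ 1, for every t ∈ {1, …, T}: (i) Σ_{s=1}^t Σ_{i=1}^d g_{s,i}²/b_{s,i}² ≤ d·log F_T; (ii) ‖m_t‖² ≤ (η²d/(1−β))·log F_T; (iii) Σ_{s=1}^t ‖m_s‖² ≤ (η²d/(1−β)²)·log F_T. -/
open MeasureTheory Finset Real

/-- The descent lemma: an upper quadratic bound for functions with Lipschitz gradient. -/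
theorem descent_of_lipschitz_gradient {E : Type*} [NormedAddCommGroup E] [InnerProductSpace ℝ E]
    [CompleteSpace E] {f : E → ℝ} {f' : E → E} {L : ℝ} (hf : ∀ p, HasGradientAt f (f' p) p)
    (hL : ∀ p q, ‖f' p - f' q‖ ≤ L * ‖p - q‖) (p w : E) :
    f (p + w) ≤ f p + inner ℝ (f' p) w + L / 2 * ‖w‖ ^ 2 := by
  have hline (r : ℝ) : HasDerivAt (fun r : ℝ => p + r • w) w r := by
    simpa using ((hasDerivAt_id r).smul_const w).const_add p
  have hderiv (r : ℝ) : HasDerivAt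
      (fun r : ℝ => f (p + r • w) - r * inner ℝ (f' p) w - L / 2 * ‖w‖ ^ 2 * r ^ 2)
      (inner ℝ (f' (p + r • w)) w - inner ℝ (f' p) w - L * ‖w‖ ^ 2 * r) r := by
    have h := (hf (p + r • w)).hasFDerivAt.comp_hasDerivAt r (hline r)
    refine ((h.sub ((hasDerivAt_id r).mul_const (inner ℝ (f' p) w))).sub
      ((hasDerivAt_pow 2 r).const_mul (L / 2 * ‖w‖ ^ 2))).congr_deriv ?_
    simp
    ring
  have hanti := antitoneOn_of_deriv_nonpos (convex_Ici (0 : ℝ))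
    (fun r _ => (hderiv r).continuousAt.continuousWithinAt)
    (fun r _ => (hderiv r).differentiableAt.differentiableWithinAt) (fun r hr => by
      rw [interior_Ici, Set.mem_Ioi] at hr
      rw [(hderiv r).deriv, ← inner_sub_left]
      have h₁ := real_inner_le_norm (f' (p + r • w) - f' p) w
      have h₂ := hL (p + r • w) p
      rw [add_sub_cancel_left, norm_smul, Real.norm_of_nonneg hr.le] at h₂
      nlinarith [mul_le_mul_of_nonneg_right h₂ (norm_nonneg w)])
  have h := hanti (Set.mem_Ici.2 le_rfl) (Set.mem_Ici.2 zero_le_one) zero_le_one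
  simp only [one_smul, zero_smul, add_zero] at h
  linarith

/-- For a function with `L`-Lipschitz gradient, the gradient is controlled by the gap to a
lower bound. -/
theorem norm_gradient_sq_le {E : Type*} [NormedAddCommGroup E] [InnerProductSpace ℝ E]
    [CompleteSpace E] {f : E → ℝ} {f' : E → E} {L c : ℝ} (hL0 : 0 < L)
    (hf : ∀ p, HasGradientAt f (f' p) p) (hL : ∀ p q, ‖f' p - f' q‖ ≤ L * ‖p - q‖)
    (hc : ∀ p, c ≤ f p) (p : E) : ‖f' p‖ ^ 2 ≤ 2 * L * (f p - c) := by
  have h := (hc _).trans (descent_of_lipschitz_gradient hf hL p (-(1 / L) • f' p))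
  rw [inner_smul_right, real_inner_self_eq_norm_sq, norm_smul, mul_pow, Real.norm_eq_abs,
    sq_abs] at h
  have hdiv : ‖f' p‖ ^ 2 / (2 * L) ≤ f p - c := by
    have : L / 2 * ((-(1 / L)) ^ 2 * ‖f' p‖ ^ 2) = ‖f' p‖ ^ 2 / (2 * L) := by field_simp
    have : -(1 / L) * ‖f' p‖ ^ 2 = -2 * (‖f' p‖ ^ 2 / (2 * L)) := by field_simp
    linarith
  rwa [div_le_iff₀' (by positivity)] at hdiv

/-- The accumulator `w` of squares in AdaGrad is nonnegative. -/
theorem adagrad_accumulator_nonneg {a w : ℕ → ℝ} (hw0 : w 0 = 0)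
    (hw : ∀ n, w (n + 1) = w n + a (n + 1) ^ 2) (n : ℕ) : 0 ≤ w n := by
  induction n with
  | zero => exact hw0.ge
  | succ n ih => rw [hw]; positivity

/-- The sum of squared normalised AdaGrad steps grows at most logarithmically. -/
theorem adagrad_sum_sq_div_le_log {ε : ℝ} (hε : 0 < ε) {a w : ℕ → ℝ} (hw0 : w 0 = 0)
    (hw : ∀ n, w (n + 1) = w n + a (n + 1) ^ 2) (t : ℕ) :
    ∑ s ∈ Icc 1 t, a s ^ 2 / (√(w s) + ε) ^ 2 ≤ Real.log (1 + w t / ε ^ 2) := by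
  induction t with
  | zero => simp [hw0]
  | succ n ih =>
    rw [Finset.sum_Icc_succ_top (by omega)]
    have h₀ := adagrad_accumulator_nonneg hw0 hw n
    have h₁ := adagrad_accumulator_nonneg hw0 hw (n + 1)
    have hp : 0 < 1 + w n / ε ^ 2 := by positivity
    have hq : 0 < 1 + w (n + 1) / ε ^ 2 := by positivity
    have hlog := Real.log_le_sub_one_of_pos (div_pos hp hq)
    rw [Real.log_div hp.ne' hq.ne'] at hlog
    have hden : w (n + 1) + ε ^ 2 ≤ (√(w (n + 1)) + ε) ^ 2 := by
      nlinarith [Real.sq_sqrt h₁, mul_nonneg (Real.sqrt_nonneg (w (n + 1))) hε.le]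
    have hfrac : a (n + 1) ^ 2 / (√(w (n + 1)) + ε) ^ 2 ≤
        a (n + 1) ^ 2 / (w (n + 1) + ε ^ 2) := by gcongr
    have heq : a (n + 1) ^ 2 / (w (n + 1) + ε ^ 2) =
        1 - (1 + w n / ε ^ 2) / (1 + w (n + 1) / ε ^ 2) := by
      have : 0 < w (n + 1) + ε ^ 2 := by positivity
      have : 0 < ε ^ 2 + w (n + 1) := by positivity
      field_simp
      rw [hw n]
      ring
    linarith

/-- A normalised AdaGrad step is at most one in absolute value. -/
theorem adagrad_sq_div_le_one {ε : ℝ} (hε : 0 < ε) {a w : ℕ → ℝ} (hw0 : w 0 = 0)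
    (hw : ∀ n, w (n + 1) = w n + a (n + 1) ^ 2) (n : ℕ) :
    a (n + 1) ^ 2 / (√(w (n + 1)) + ε) ^ 2 ≤ 1 := by
  have h₀ := adagrad_accumulator_nonneg hw0 hw n
  have h₁ := adagrad_accumulator_nonneg hw0 hw (n + 1)
  apply div_le_one_of_le₀ _ (by positivity)
  nlinarith [Real.sq_sqrt h₁, mul_nonneg (Real.sqrt_nonneg (w (n + 1))) hε.le, hw n]

/-- Convexity of the square applied to one momentum step. -/
theorem sq_momentum_step_le {β : ℝ} (hβ0 : 0 ≤ β) (hβ1 : β < 1) (η a y : ℝ) :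
    (β * a - η * y) ^ 2 ≤ β * a ^ 2 + η ^ 2 / (1 - β) * y ^ 2 := by
  have h : 0 < 1 - β := by linarith
  have key : β * a ^ 2 + η ^ 2 / (1 - β) * y ^ 2 - (β * a - η * y) ^ 2 =
      β / (1 - β) * ((1 - β) * a + η * y) ^ 2 := by
    field_simp
    ring
  have : 0 ≤ β / (1 - β) * ((1 - β) * a + η * y) ^ 2 := by positivity
  linarith

/-- A contraction `p (n + 1) ≤ β * p n + q (n + 1)` bounds the last term by the sum of the
inputs. -/
theorem contraction_le_sum {β : ℝ} (hβ1 : β < 1) {p q : ℕ → ℝ}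
    (hp : ∀ n, 0 ≤ p n) (hp0 : p 0 = 0) (hrec : ∀ n, p (n + 1) ≤ β * p n + q (n + 1)) (t : ℕ) :
    p t ≤ ∑ s ∈ Icc 1 t, q s := by
  induction t with
  | zero => simp [hp0]
  | succ n ih =>
    rw [Finset.sum_Icc_succ_top (by omega)]
    nlinarith [hrec n, hp n]

/-- A contraction `p (n + 1) ≤ β * p n + q (n + 1)` bounds the sum of its terms by the sum of the
inputs. -/
theorem contraction_sum_le {β : ℝ} (hβ0 : 0 ≤ β) {p q : ℕ → ℝ}
    (hp : ∀ n, 0 ≤ p n) (hp0 : p 0 = 0) (hrec : ∀ n, p (n + 1) ≤ β * p n + q (n + 1)) (t : ℕ) :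
    (1 - β) * ∑ s ∈ Icc 1 t, p s ≤ ∑ s ∈ Icc 1 t, q s := by
  have h : (1 - β) * ∑ s ∈ Icc 1 t, p s + β * p t ≤ ∑ s ∈ Icc 1 t, q s := by
    induction t with
    | zero => simp [hp0]
    | succ n ih =>
      rw [Finset.sum_Icc_succ_top (by omega), Finset.sum_Icc_succ_top (by omega)]
      linarith [hrec n]
  linarith [mul_nonneg hβ0 (hp t)]

theorem stmt_10
    {d : ℕ} (β η ε : ℝ) (hβ0 : 0 ≤ β) (hβ1 : β < 1) (hη : 0 < η) (hε : 0 < ε)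
    (g v m x : ℕ → EuclideanSpace ℝ (Fin d))
    (hv0 : v 0 = 0) (hm0 : m 0 = 0) (hx0 : x 0 = x 1)
    (hv : ∀ s, 1 ≤ s → ∀ i, v s i = v (s - 1) i + g s i ^ 2)
    (hmrec : ∀ s, 1 ≤ s → ∀ i,
      m s i = β * m (s - 1) i - η * g s i / (Real.sqrt (v s i) + ε))
    (hxrec : ∀ s, 1 ≤ s → x (s + 1) = x s + m s)
    (f : EuclideanSpace ℝ (Fin d) → ℝ) (fgrad : EuclideanSpace ℝ (Fin d) → EuclideanSpace ℝ (Fin d))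
    (hgrad : ∀ p, HasGradientAt f (fgrad p) p)
    (L : ℝ) (hL : 0 < L)
    (hsmooth : ∀ p q, ‖fgrad p - fgrad q‖ ≤ L * ‖p - q‖)
    (fstar : ℝ) (hfstar : ∀ p, fstar ≤ f p)
    (A B C : ℝ) (hA : 0 < A) (hB : 0 < B) (hC : 0 < C)
    (hnoise : ∀ s, 1 ≤ s →
      ‖g s - fgrad (x s)‖ ^ 2 ≤ A * (f (x s) - fstar) + B * ‖fgrad (x s)‖ ^ 2 + C)
    (b : ℕ → Fin d → ℝ)
    (hb : ∀ s i, b s i = Real.sqrt (v s i) + ε)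
    (T : ℕ) (hT : 1 ≤ T)
    (X : ℝ) (hX : X = 2 * A + 4 * L * B + 4 * L)
    (FT : ℝ)
    (hFT : FT = 1 + 1 / ε ^ 2 *
      ((X * (f (x 1) - fstar) + 2 * C) * (T : ℝ) +
        (η * ‖fgrad (x 1)‖ * Real.sqrt (d : ℝ) / (1 - β) +
          L * η ^ 2 * (d : ℝ) / (2 * (1 - β) ^ 2)) * X * (T : ℝ) ^ 2 +
        L * η ^ 2 * (d : ℝ) * X * (T : ℝ) ^ 3 / (1 - β) ^ 2)) :
    ∀ t ∈ Finset.Icc 1 T,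
      (∑ s ∈ Finset.Icc 1 t, ∑ i, g s i ^ 2 / b s i ^ 2 ≤ (d : ℝ) * Real.log FT) ∧
      (‖m t‖ ^ 2 ≤ η ^ 2 * (d : ℝ) / (1 - β) * Real.log FT) ∧
      (∑ s ∈ Finset.Icc 1 t, ‖m s‖ ^ 2 ≤ η ^ 2 * (d : ℝ) / (1 - β) ^ 2 * Real.log FT) := by
  have h1β : 0 < 1 - β := by linarith
  have hv0' (i) : v 0 i = 0 := by simp [hv0]
  have hvS (i n) : v (n + 1) i = v n i + g (n + 1) i ^ 2 := hv (n + 1) (by omega) i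
  set q : ℕ → ℝ := fun s => ∑ i, g s i ^ 2 / b s i ^ 2 with hq
  have hmom (n) : ‖m (n + 1)‖ ^ 2 ≤ β * ‖m n‖ ^ 2 + η ^ 2 / (1 - β) * q (n + 1) := by
    rw [EuclideanSpace.real_norm_sq_eq, EuclideanSpace.real_norm_sq_eq, hq, Finset.mul_sum,
      Finset.mul_sum, ← Finset.sum_add_distrib]
    refine Finset.sum_le_sum fun i _ => ?_
    rw [hmrec (n + 1) (by omega) i, ← hb, mul_div_assoc, ← div_pow]
    exact sq_momentum_step_le hβ0 hβ1 _ _ _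
  have hq_le (n) : q (n + 1) ≤ d := by
    calc q (n + 1) ≤ ∑ _i : Fin d, (1 : ℝ) := Finset.sum_le_sum fun i _ => by
          rw [hb]
          exact adagrad_sq_div_le_one (a := fun s => g s i) (w := fun s => v s i) hε
            (hv0' i) (hvS i) n
      _ = d := by simp
  set D : ℝ := η * √(d : ℝ) / (1 - β) with hD
  have hD0 : 0 ≤ D := by positivity
  have hD2 : D ^ 2 = η ^ 2 * d / (1 - β) ^ 2 := by
    rw [hD, div_pow, mul_pow, Real.sq_sqrt (Nat.cast_nonneg d)]
  have hmD (n) : ‖m n‖ ≤ D := by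
    refine le_of_sq_le_sq ?_ hD0
    induction n with
    | zero => simpa [hm0] using sq_nonneg D
    | succ n ih =>
      have h₁ : η ^ 2 / (1 - β) * q (n + 1) ≤ η ^ 2 / (1 - β) * d := by
        gcongr
        exact hq_le n
      have h₂ : η ^ 2 / (1 - β) * d = (1 - β) * D ^ 2 := by rw [hD2]; field_simp
      linarith [hmom n, mul_le_mul_of_nonneg_left ih hβ0]
  have hxD (n : ℕ) : ‖x (n + 1) - x 1‖ ≤ n * D := by
    induction n with
    | zero => simp
    | succ n ih =>
      rw [hxrec (n + 1) (by omega), add_sub_right_comm]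
      push_cast
      linarith [norm_add_le (x (n + 1) - x 1) (m (n + 1)), hmD (n + 1)]
  have hX0 : 0 < X := by rw [hX]; positivity
  set K : ℝ := X * (f (x 1) - fstar) + 2 * C +
    X * (‖fgrad (x 1)‖ * D * T + L / 2 * D ^ 2 * T ^ 2) with hK
  have hgK (n : ℕ) (hn : n + 1 ≤ T) : ‖g (n + 1)‖ ^ 2 ≤ K := by
    have hnT : (n : ℝ) ≤ T := by exact_mod_cast (by omega : n ≤ T)
    have hstep : ‖x (n + 1) - x 1‖ ≤ D * T := (hxD n).trans (by nlinarith)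
    have hdesc := descent_of_lipschitz_gradient hgrad hsmooth (x 1) (x (n + 1) - x 1)
    rw [add_sub_cancel] at hdesc
    have h₁ : inner ℝ (fgrad (x 1)) (x (n + 1) - x 1) ≤ ‖fgrad (x 1)‖ * (D * T) :=
      (real_inner_le_norm _ _).trans (by gcongr)
    have h₂ : L / 2 * ‖x (n + 1) - x 1‖ ^ 2 ≤ L / 2 * (D * T) ^ 2 := by gcongr
    have hgap : f (x (n + 1)) - fstar ≤ f (x 1) - fstar +
        (‖fgrad (x 1)‖ * D * T + L / 2 * D ^ 2 * T ^ 2) := by linarith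
    have hgrad_sq := norm_gradient_sq_le hL hgrad hsmooth hfstar (x (n + 1))
    have htri : ‖g (n + 1)‖ ^ 2 ≤
        2 * (‖g (n + 1) - fgrad (x (n + 1))‖ ^ 2 + ‖fgrad (x (n + 1))‖ ^ 2) := by
      have h := norm_add_le (g (n + 1) - fgrad (x (n + 1))) (fgrad (x (n + 1)))
      rw [sub_add_cancel] at h
      exact (pow_le_pow_left₀ (norm_nonneg _) h 2).trans add_sq_le
    have hns := hnoise (n + 1) (by omega)
    have h₃ : ‖g (n + 1)‖ ^ 2 ≤ X * (f (x (n + 1)) - fstar) + 2 * C := by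
      rw [hX]
      linarith [mul_le_mul_of_nonneg_left hgrad_sq hB.le]
    rw [hK]
    linarith [mul_le_mul_of_nonneg_left hgap hX0.le]
  have hK0 : 0 ≤ K := (sq_nonneg _).trans (hgK 0 hT)
  have hvK (i : Fin d) (t : ℕ) (ht : t ≤ T) : v t i ≤ t * K := by
    induction t with
    | zero => simp [hv0]
    | succ n ih =>
      have h := hgK n ht
      rw [EuclideanSpace.real_norm_sq_eq] at h
      have h' := Finset.single_le_sum (f := fun i => g (n + 1) i ^ 2)
        (fun j _ => sq_nonneg _) (Finset.mem_univ i)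
      rw [hvS]
      push_cast
      linarith [ih (by omega)]
  have hKF : 1 + T * K / ε ^ 2 ≤ FT := by
    have h : η ^ 2 * (d : ℝ) = D ^ 2 * (1 - β) ^ 2 := by rw [hD2]; field_simp
    have h₁ : L * η ^ 2 * (d : ℝ) / (2 * (1 - β) ^ 2) = L * D ^ 2 / 2 := by
      rw [mul_assoc L, h]; field_simp
    have h₂ : L * η ^ 2 * (d : ℝ) * X * (T : ℝ) ^ 3 / (1 - β) ^ 2 =
        L * D ^ 2 * X * (T : ℝ) ^ 3 := by
      rw [mul_assoc L, h]; field_simp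
    have h₃ : η * ‖fgrad (x 1)‖ * √(d : ℝ) / (1 - β) = ‖fgrad (x 1)‖ * D := by
      rw [hD]; ring
    rw [hFT, h₁, h₂, h₃, div_eq_inv_mul, one_div]
    gcongr
    have h₄ : 0 ≤ L * D ^ 2 / 2 * X * (T : ℝ) ^ 2 := by positivity
    have h₅ : 0 ≤ L * D ^ 2 / 2 * X * (T : ℝ) ^ 3 := by positivity
    rw [hK]
    linarith
  intro t ht
  obtain ⟨-, htT⟩ := Finset.mem_Icc.1 ht
  have hsum : ∑ s ∈ Icc 1 t, q s ≤ d * Real.log FT := by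
    rw [hq, Finset.sum_comm]
    calc ∑ i, ∑ s ∈ Icc 1 t, g s i ^ 2 / b s i ^ 2 ≤ ∑ _i : Fin d, Real.log FT := by
          refine Finset.sum_le_sum fun i _ => ?_
          have hpos := adagrad_accumulator_nonneg (a := fun s => g s i) (w := fun s => v s i)
            (hv0' i) (hvS i) t
          simp only [hb]
          refine (adagrad_sum_sq_div_le_log (a := fun s => g s i) (w := fun s => v s i) hε
            (hv0' i) (hvS i) t).trans (Real.log_le_log (by positivity) (le_trans ?_ hKF))
          have : v t i ≤ T * K := (hvK i t htT).trans (by gcongr)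
          gcongr
      _ = d * Real.log FT := by simp
  have hscaled : ∑ s ∈ Icc 1 t, η ^ 2 / (1 - β) * q s ≤ η ^ 2 * d / (1 - β) * Real.log FT := by
    rw [← Finset.mul_sum]
    calc _ ≤ η ^ 2 / (1 - β) * (d * Real.log FT) := by gcongr
      _ = _ := by ring
  have hnn (n) : 0 ≤ ‖m n‖ ^ 2 := sq_nonneg _
  have hm0' : ‖m 0‖ ^ 2 = 0 := by simp [hm0]
  refine ⟨hsum, (contraction_le_sum (q := fun s => η ^ 2 / (1 - β) * q s) hβ1 hnn hm0' hmom
    t).trans hscaled, ?_⟩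
  have h := (contraction_sum_le (q := fun s => η ^ 2 / (1 - β) * q s) hβ0 hnn hm0' hmom
    t).trans hscaled
  rw [← le_div_iff₀' h1β] at h
  refine h.trans_eq ?_
  field_simp
end

section
/- For the AdaGrad-with-momentum iterates with β ∈ [0,1), for every s ≥ 1: max{‖x_{s+1} − x_s‖, ‖y_s − x_s‖, ‖y_{s+1} − y_s‖} ≤ η√d/(1−β)². Consequently, for any L₁ > 0, if η ≤ (1−β)²/(L₁√d), then max{‖x_{s+1} − x_s‖, ‖y_s − x_s‖, ‖y_{s+1} − y_s‖} ≤ 1/L₁ for every s ≥ 1. -/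
open MeasureTheory Finset Real

theorem EuclideanSpace.norm_le_mul_sqrt_of_forall_abs_le {d : ℕ} {z : EuclideanSpace ℝ (Fin d)}
    {c : ℝ} (hc : 0 ≤ c) (h : ∀ i, |z i| ≤ c) : ‖z‖ ≤ c * √(d : ℝ) := by
  rw [EuclideanSpace.norm_eq]
  refine Real.sqrt_le_iff.2 ⟨by positivity, ?_⟩
  have hsum : ∑ i, ‖z i‖ ^ 2 ≤ ∑ _i : Fin d, c ^ 2 :=
    Finset.sum_le_sum fun i _ => pow_le_pow_left₀ (norm_nonneg _) (h i) 2
  rw [mul_pow, Real.sq_sqrt (Nat.cast_nonneg d)]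
  simpa [mul_comm] using hsum

theorem abs_div_sqrt_add_le_one {a w ε : ℝ} (hε : 0 < ε) (h : a ^ 2 ≤ w) :
    |a / (√w + ε)| ≤ 1 := by
  have hb : 0 < √w + ε := by positivity
  rw [abs_div, abs_of_pos hb, div_le_one hb]
  linarith [Real.abs_le_sqrt h]

/-- A scalar recursion contracting with factor `β`, perturbed by at most `η` at each step. -/
theorem abs_le_div_one_sub_of_abs_sub_mul_le {β η : ℝ} (hβ0 : 0 ≤ β) (hβ1 : β < 1) (hη : 0 ≤ η)
    {u : ℕ → ℝ} (h0 : u 0 = 0) (hstep : ∀ n, |u (n + 1) - β * u n| ≤ η) (n : ℕ) :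
    |u n| ≤ η / (1 - β) := by
  have hb : 0 < 1 - β := by linarith
  induction n with
  | zero => rw [h0, abs_zero]; positivity
  | succ n ih =>
    have h1 : |u (n + 1)| ≤ |u (n + 1) - β * u n| + |β * u n| := by
      simpa using abs_add_le (u (n + 1) - β * u n) (β * u n)
    rw [abs_mul, abs_of_nonneg hβ0] at h1
    calc |u (n + 1)| ≤ η + β * (η / (1 - β)) :=
          h1.trans (add_le_add (hstep n) (mul_le_mul_of_nonneg_left ih hβ0))
      _ = η / (1 - β) := by field_simp; ring

theorem stmt_11
    {d : ℕ} (β η ε : ℝ) (hβ0 : 0 ≤ β) (hβ1 : β < 1) (hη : 0 < η) (hε : 0 < ε)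
    (g v m x : ℕ → EuclideanSpace ℝ (Fin d))
    (hv0 : v 0 = 0) (hm0 : m 0 = 0) (hx0 : x 0 = x 1)
    (hv : ∀ s, 1 ≤ s → ∀ i, v s i = v (s - 1) i + g s i ^ 2)
    (hmrec : ∀ s, 1 ≤ s → ∀ i,
      m s i = β * m (s - 1) i - η * g s i / (Real.sqrt (v s i) + ε))
    (hxrec : ∀ s, 1 ≤ s → x (s + 1) = x s + m s)
    (y : ℕ → EuclideanSpace ℝ (Fin d))
    (hy1 : y 1 = x 1)
    (hy : ∀ s, 2 ≤ s → y s = x s + (β / (1 - β)) • (x s - x (s - 1)))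
 :
    (∀ s, 1 ≤ s →
      max (max ‖x (s + 1) - x s‖ ‖y s - x s‖) ‖y (s + 1) - y s‖ ≤
        η * Real.sqrt (d : ℝ) / (1 - β) ^ 2) ∧
    (∀ L₁ : ℝ, 0 < L₁ → η ≤ (1 - β) ^ 2 / (L₁ * Real.sqrt (d : ℝ)) →
      ∀ s, 1 ≤ s →
        max (max ‖x (s + 1) - x s‖ ‖y s - x s‖) ‖y (s + 1) - y s‖ ≤ 1 / L₁) := by
  have hb : 0 < 1 - β := by linarith
  have hb1 : 1 - β ≤ 1 := by linarith
  have hv_nonneg : ∀ s i, 0 ≤ v s i := by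
    intro s i
    induction s with
    | zero => simp [hv0]
    | succ n ih =>
      have h := hv (n + 1) (by omega) i
      rw [Nat.add_sub_cancel] at h
      rw [h]; positivity
  have hstep : ∀ i n, |m (n + 1) i - β * m n i| ≤ η := by
    intro i n
    have h1 := hmrec (n + 1) (by omega) i
    have h2 := hv (n + 1) (by omega) i
    rw [Nat.add_sub_cancel] at h1 h2
    have h3 : m (n + 1) i - β * m n i = -(η * (g (n + 1) i / (√(v (n + 1) i) + ε))) := by
      rw [h1]; ring
    rw [h3, abs_neg, abs_mul, abs_of_pos hη]
    exact mul_le_of_le_one_right hη.le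
      (abs_div_sqrt_add_le_one hε (by linarith [hv_nonneg n i]))
  have hm_le : ∀ n i, |m n i| ≤ η / (1 - β) := fun n i =>
    abs_le_div_one_sub_of_abs_sub_mul_le (u := fun n => m n i) hβ0 hβ1 hη.le (by simp [hm0])
      (hstep i) n
  have hy_eq : ∀ n, y (n + 1) = x (n + 1) + (β / (1 - β)) • m n := by
    rintro (_ | n)
    · simp [hy1, hm0]
    · rw [hy (n + 2) (by omega), show n + 2 - 1 = n + 1 by omega, hxrec (n + 1) (by omega),
        add_sub_cancel_left]
  have hc : η / (1 - β) ≤ η / (1 - β) ^ 2 :=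
    div_le_div_of_nonneg_left hη.le (by positivity) (by nlinarith)
  have hbound : ∀ s, 1 ≤ s →
      max (max ‖x (s + 1) - x s‖ ‖y s - x s‖) ‖y (s + 1) - y s‖ ≤
        η * √(d : ℝ) / (1 - β) ^ 2 := by
    intro s hs
    obtain ⟨n, rfl⟩ := Nat.exists_eq_add_of_le' hs
    rw [mul_div_right_comm]
    refine max_le (max_le ?_ ?_) ?_ <;>
      refine EuclideanSpace.norm_le_mul_sqrt_of_forall_abs_le (by positivity) fun i => ?_
    · rw [hxrec (n + 1) hs, add_sub_cancel_left]
      exact (hm_le _ i).trans hc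
    · rw [hy_eq n, add_sub_cancel_left, PiLp.smul_apply, smul_eq_mul, abs_mul,
        abs_of_nonneg (by positivity : 0 ≤ β / (1 - β))]
      calc β / (1 - β) * |m n i| ≤ 1 / (1 - β) * (η / (1 - β)) := by
            gcongr
            exact hm_le n i
        _ = η / (1 - β) ^ 2 := by field_simp
    · have h : (y (n + 1 + 1) - y (n + 1)) i = (m (n + 1) i - β * m n i) / (1 - β) := by
        rw [hy_eq (n + 1), hy_eq n, hxrec (n + 1) hs]
        simp only [PiLp.sub_apply, PiLp.add_apply, PiLp.smul_apply, smul_eq_mul]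
        field_simp
        ring
      rw [h, abs_div, abs_of_pos hb]
      exact (div_le_div_of_nonneg_right (hstep i n) hb.le).trans hc
  refine ⟨hbound, fun L₁ hL hηL s hs => (hbound s hs).trans ?_⟩
  rcases (Real.sqrt_nonneg (d : ℝ)).eq_or_lt with hd | hd
  · rw [← hd, mul_zero, zero_div]
    positivity
  · rw [le_div_iff₀ (by positivity)] at hηL
    rw [div_le_div_iff₀ (by positivity) hL]
    linarith
end

section
/- Suppose f is (L₀,L₁)-smooth and bounded below by f*, β ∈ [0,1), and η ≤ (1−β)²/(L₁√d). Then for the AdaGrad-with-momentum iterates, for every s ≥ 1: ‖m_s‖ ≤ η√d/(1−β) and ‖∇f(x_s)‖ ≤ ‖∇f(x₁)‖ + (η√d/(1−β))·Σ_{j=1}^s 𝓛_j. -/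
open MeasureTheory Finset Real

/-- A function with an `(L₀, L₁)`-smooth gradient that is bounded below has its gradient controlled
by the function value gap. -/
theorem norm_gradient_le_of_generalized_smooth {E : Type*} [NormedAddCommGroup E]
    [InnerProductSpace ℝ E] [CompleteSpace E] {f : E → ℝ} {f' : E → E}
    (hf : ∀ p, HasGradientAt f (f' p) p) {L₀ L₁ : ℝ} (hL₀ : 0 < L₀) (hL₁ : 0 < L₁)
    (hsmooth : ∀ p q, ‖p - q‖ ≤ 1 / L₁ → ‖f' q - f' p‖ ≤ (L₀ + L₁ * ‖f' p‖) * ‖p - q‖)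
    {c : ℝ} (hc : ∀ p, c ≤ f p) (p : E) :
    ‖f' p‖ ≤ 4 * L₁ * (f p - c) + √(4 * L₀ * (f p - c)) := by
  set u := f' p
  set G := ‖u‖
  set K := L₀ + L₁ * G with hK
  have hG : 0 ≤ G := norm_nonneg _
  have hKpos : 0 < K := by positivity
  have hder (t : ℝ) :
      HasDerivAt (fun t : ℝ ↦ f (p - t • u)) (-inner ℝ (f' (p - t • u)) u) t := by
    have hline : HasDerivAt (fun t : ℝ ↦ p - t • u) (-u) t := by
      simpa using ((hasDerivAt_id t).smul_const u).const_sub p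
    have h := (hf (p - t • u)).hasFDerivAt.comp_hasDerivAt t hline
    rwa [InnerProductSpace.toDual_apply_apply, inner_neg_right] at h
  obtain ⟨t, ⟨ht0, ht1⟩, ht⟩ := exists_hasDerivAt_eq_slope (fun t : ℝ ↦ f (p - t • u)) _
    (show (0 : ℝ) < 1 / (2 * K) by positivity)
    (fun t _ ↦ (hder t).continuousAt.continuousWithinAt) (fun t _ ↦ hder t)
  have htK : t * (2 * K) < 1 := (lt_div_iff₀ (by positivity)).1 ht1
  have hdist : ‖p - (p - t • u)‖ = t * G := by
    rw [sub_sub_cancel, norm_smul, Real.norm_of_nonneg ht0.le]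
  have hclose : ‖p - (p - t • u)‖ ≤ 1 / L₁ := by
    rw [hdist, le_div_iff₀ hL₁]
    nlinarith [mul_pos ht0 hL₀, mul_nonneg ht0.le (mul_nonneg hL₁.le hG)]
  have hinner : G ^ 2 / 2 ≤ inner ℝ (f' (p - t • u)) u := by
    have hdiff := hsmooth p (p - t • u) hclose
    rw [hdist] at hdiff
    have hcs := real_inner_le_norm (u - f' (p - t • u)) u
    rw [inner_sub_left, real_inner_self_eq_norm_sq, norm_sub_rev] at hcs
    have := mul_le_mul_of_nonneg_right hdiff hG
    change _ ≤ K * (t * G) * G at this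
    nlinarith [mul_le_mul_of_nonneg_right htK.le (sq_nonneg G)]
  have hdescent : G ^ 2 ≤ 4 * K * (f p - c) := by
    rw [eq_div_iff (by simp [hKpos.ne'])] at ht
    simp only [zero_smul, sub_zero] at ht
    have hlow := hc (p - (1 / (2 * K)) • u)
    have hstep : G ^ 2 / 2 * (1 / (2 * K)) ≤ f p - c := by
      nlinarith [mul_le_mul_of_nonneg_right hinner (show 0 ≤ 1 / (2 * K) by positivity)]
    calc G ^ 2 = 4 * K * (G ^ 2 / 2 * (1 / (2 * K))) := by field_simp; ring
      _ ≤ _ := by gcongr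
  have hgap : 0 ≤ f p - c := sub_nonneg.2 (hc p)
  have hsqrt := Real.sq_sqrt (show 0 ≤ 4 * L₀ * (f p - c) by positivity)
  have hsqrt0 := Real.sqrt_nonneg (4 * L₀ * (f p - c))
  have hlin : 0 ≤ 4 * L₁ * (f p - c) := by positivity
  by_contra! hlt
  nlinarith

/-- The Euclidean norm of a vector is at most `√d` times a bound on its coordinates. -/
theorem EuclideanSpace.norm_le_sqrt_card_mul {ι : Type*} [Fintype ι] {z : EuclideanSpace ℝ ι}
    {B : ℝ} (hB : 0 ≤ B) (hz : ∀ i, |z i| ≤ B) : ‖z‖ ≤ √(Fintype.card ι) * B := by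
  rw [EuclideanSpace.norm_eq, Real.sqrt_le_left (by positivity), mul_pow,
    Real.sq_sqrt (by positivity)]
  calc ∑ i, ‖z i‖ ^ 2 ≤ ∑ _i : ι, B ^ 2 := by
        gcongr with i
        exact hz i
    _ = _ := by simp

/-- Heavy-ball averaging of increments bounded by `η` stays bounded by `η / (1 - β)`. -/
theorem abs_momentum_le {β η : ℝ} (hβ0 : 0 ≤ β) (hβ1 : β < 1) (hη : 0 ≤ η) {a b : ℕ → ℝ}
    (ha0 : a 0 = 0) (ha : ∀ s, a (s + 1) = β * a s - b s) (hb : ∀ s, |b s| ≤ η) (s : ℕ) :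
    |a s| ≤ η / (1 - β) := by
  have hβ : 0 < 1 - β := sub_pos.2 hβ1
  induction s with
  | zero => rw [ha0, abs_zero]; positivity
  | succ s ih =>
    calc |a (s + 1)| ≤ |β * a s| + |b s| := by rw [ha]; exact abs_sub _ _
      _ ≤ β * (η / (1 - β)) + η := by
        rw [abs_mul, abs_of_nonneg hβ0]
        gcongr
        exact hb s
      _ = η / (1 - β) := by field_simp; ring

/-- An AdaGrad step is bounded by its step size. -/
theorem abs_adagrad_step_le {η ε a w : ℝ} (hη : 0 ≤ η) (hε : 0 < ε) (hw : a ^ 2 ≤ w) :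
    |η * a / (√w + ε)| ≤ η := by
  have hpos : 0 < √w + ε := by positivity
  rw [abs_div, abs_mul, abs_of_nonneg hη, abs_of_pos hpos, div_le_iff₀ hpos]
  gcongr
  linarith [Real.abs_le_sqrt hw]


theorem stmt_13
    {d : ℕ} (β η ε : ℝ) (hβ0 : 0 ≤ β) (hβ1 : β < 1) (hη : 0 < η) (hε : 0 < ε)
    (g v m x : ℕ → EuclideanSpace ℝ (Fin d))
    (hv0 : v 0 = 0) (hm0 : m 0 = 0) (hx0 : x 0 = x 1)
    (hv : ∀ s, 1 ≤ s → ∀ i, v s i = v (s - 1) i + g s i ^ 2)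
    (hmrec : ∀ s, 1 ≤ s → ∀ i,
      m s i = β * m (s - 1) i - η * g s i / (Real.sqrt (v s i) + ε))
    (hxrec : ∀ s, 1 ≤ s → x (s + 1) = x s + m s)
    (f : EuclideanSpace ℝ (Fin d) → ℝ) (fgrad : EuclideanSpace ℝ (Fin d) → EuclideanSpace ℝ (Fin d))
    (hgrad : ∀ p, HasGradientAt f (fgrad p) p)
    (L₀ L₁ : ℝ) (hL₀ : 0 < L₀) (hL₁ : 0 < L₁)
    (hgen : ∀ p q, ‖p - q‖ ≤ 1 / L₁ →
      ‖fgrad q - fgrad p‖ ≤ (L₀ + L₁ * ‖fgrad p‖) * ‖p - q‖)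
    (fstar : ℝ) (hfstar : ∀ p, fstar ≤ f p)
    (hηgen : η ≤ (1 - β) ^ 2 / (L₁ * Real.sqrt (d : ℝ)))
    (Ls : ℕ → ℝ)
    (hLs : ∀ s, Ls s = 2 * L₀ + 2 * L₁ *
      (4 * L₁ * (f (x s) - fstar) + Real.sqrt (4 * L₀ * (f (x s) - fstar))))
 :
    ∀ s, 1 ≤ s →
      ‖m s‖ ≤ η * Real.sqrt (d : ℝ) / (1 - β) ∧
      ‖fgrad (x s)‖ ≤ ‖fgrad (x 1)‖ +
        η * Real.sqrt (d : ℝ) / (1 - β) * ∑ j ∈ Finset.Icc 1 s, Ls j := by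
  have hβ : 0 < 1 - β := sub_pos.2 hβ1
  have hvnonneg (s : ℕ) (i : Fin d) : 0 ≤ v s i := by
    induction s with
    | zero => simp [hv0]
    | succ s ih =>
      rw [hv (s + 1) (by simp) i, Nat.add_sub_cancel]
      positivity
  have hmcoord (s : ℕ) (i : Fin d) : |m s i| ≤ η / (1 - β) := by
    refine abs_momentum_le hβ0 hβ1 hη.le (a := fun s ↦ m s i) (by simp [hm0])
      (fun s ↦ hmrec (s + 1) (by simp) i) (fun s ↦ abs_adagrad_step_le hη.le hε ?_) s
    rw [hv (s + 1) (by simp) i]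
    exact le_add_of_nonneg_left (hvnonneg _ i)
  have hm (s : ℕ) : ‖m s‖ ≤ η * √(d : ℝ) / (1 - β) := by
    have h := EuclideanSpace.norm_le_sqrt_card_mul (by positivity) (hmcoord s)
    rwa [Fintype.card_fin, ← mul_div_assoc, mul_comm] at h
  have hd : 0 < √(d : ℝ) := by
    refine (Real.sqrt_nonneg _).lt_of_ne fun h ↦ ?_
    rw [← h, mul_zero, div_zero] at hηgen
    exact hη.not_ge hηgen
  have hradius : η * √(d : ℝ) / (1 - β) ≤ 1 / L₁ := by
    rw [le_div_iff₀ (by positivity)] at hηgen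
    rw [div_le_div_iff₀ hβ hL₁]
    nlinarith
  have hLs_ge (s : ℕ) : L₀ + L₁ * ‖fgrad (x s)‖ ≤ Ls s := by
    have h := norm_gradient_le_of_generalized_smooth hgrad hL₀ hL₁ hgen hfstar (x s)
    rw [hLs]
    nlinarith [norm_nonneg (fgrad (x s)), mul_le_mul_of_nonneg_left h hL₁.le,
      mul_nonneg hL₁.le (norm_nonneg (fgrad (x s)))]
  have hLs0 (s : ℕ) : 0 ≤ Ls s := le_trans (by positivity) (hLs_ge s)
  have hstep (s : ℕ) (hs : 1 ≤ s) :
      ‖fgrad (x (s + 1))‖ ≤ ‖fgrad (x s)‖ + η * √(d : ℝ) / (1 - β) * Ls s := by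
    have hdist : ‖x s - x (s + 1)‖ ≤ η * √(d : ℝ) / (1 - β) := by
      rw [norm_sub_rev, hxrec s hs, add_sub_cancel_left]
      exact hm s
    calc ‖fgrad (x (s + 1))‖
        ≤ ‖fgrad (x s)‖ + ‖fgrad (x (s + 1)) - fgrad (x s)‖ := norm_le_norm_add_norm_sub' _ _
      _ ≤ ‖fgrad (x s)‖ + (L₀ + L₁ * ‖fgrad (x s)‖) * ‖x s - x (s + 1)‖ := by
        gcongr
        exact hgen _ _ (hdist.trans hradius)
      _ ≤ ‖fgrad (x s)‖ + Ls s * (η * √(d : ℝ) / (1 - β)) := by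
        gcongr
        · exact hLs0 s
        · exact hLs_ge s
      _ = _ := by rw [mul_comm (Ls s)]
  have hsum (s : ℕ) : ‖fgrad (x (s + 1))‖ ≤
      ‖fgrad (x 1)‖ + η * √(d : ℝ) / (1 - β) * ∑ j ∈ Finset.Icc 1 s, Ls j := by
    induction s with
    | zero => simp
    | succ s ih =>
      rw [Finset.sum_Icc_succ_top (by simp), mul_add, ← add_assoc]
      exact (hstep (s + 1) (by simp)).trans (by gcongr)
  intro s hs
  refine ⟨hm s, ?_⟩
  obtain ⟨s, rfl⟩ := Nat.exists_eq_add_of_le' hs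
  refine (hsum s).trans ?_
  gcongr
  · exact fun j _ _ ↦ hLs0 j
  · exact Nat.le_succ s
end
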